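/- arXiv:1710.03389 — 2 statements merged into one kernel-verified Lean document; each statement's English description precedes it below -/
import Mathlib

section
/- Let k₁ = (2π/√3)(1, √3), k₂ = (2π/√3)(1, −√3), Λ_h* = ℤk₁ ⊕ ℤk₂, R = [[−1/2, √3/2], [−√3/2, −1/2]], and K = (1/3)(k₁ − k₂) = (0, 4π/3). For k ∈ ℝ², the image set R(k + Λ_h*) = {R(k + w) : w ∈ Λ_h*} equals k + Λ_h* if and only if k ∈ Λ_h* ∪ (K + Λ_h*) ∪ (−K + Λ_h*), i.e. if and only if k is congruent to 0, K, or −K modulo Λ_h*. -/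
open Matrix

noncomputable section

abbrev V2 : Type := Fin 2 → ℝ

/-- The 120° clockwise rotation matrix. -/
def Rmat : Matrix (Fin 2) (Fin 2) ℝ := !![-1/2, Real.sqrt 3/2; -Real.sqrt 3/2, -1/2]

/-- Dual basis vector `k₁ = (2π/√3)(1, √3)`. -/
def kv1 : V2 := ![2 * Real.pi / Real.sqrt 3, 2 * Real.pi]

/-- Dual basis vector `k₂ = (2π/√3)(1, -√3)`. -/
def kv2 : V2 := ![2 * Real.pi / Real.sqrt 3, -(2 * Real.pi)]

/-- The dual lattice `Λ_h* = ℤk₁ ⊕ ℤk₂`. -/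
def Lstar : Set V2 := {w | ∃ m n : ℤ, w = m • kv1 + n • kv2}

/-- The vertex `K = (1/3)(k₁ - k₂) = (0, 4π/3)`. -/
def Kpt : V2 := ![0, 4 * Real.pi / 3]

theorem Rmat_mulVec_kv1 : Rmat *ᵥ kv1 = kv2 := by
  have h : Real.sqrt 3 ≠ 0 := by positivity
  have h3 : Real.sqrt 3 ^ 2 = 3 := Real.sq_sqrt (by norm_num)
  ext i
  fin_cases i <;> simp [Rmat, kv1, kv2, Matrix.mulVec, dotProduct, Fin.sum_univ_two] <;>
    field_simp <;> linarith

theorem Rmat_mulVec_kv2 : Rmat *ᵥ kv2 = -kv1 - kv2 := by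
  have h : Real.sqrt 3 ≠ 0 := by positivity
  have h3 : Real.sqrt 3 ^ 2 = 3 := Real.sq_sqrt (by norm_num)
  ext i
  fin_cases i <;> simp [Rmat, kv1, kv2, Matrix.mulVec, dotProduct, Fin.sum_univ_two] <;>
    field_simp <;> linarith

theorem three_smul_Kpt : (3 : ℝ) • Kpt = kv1 - kv2 := by
  ext i
  fin_cases i <;> simp [Kpt, kv1, kv2]
  ring

/-- `R` satisfies `R² + R + 1 = 0`. -/
theorem Rmat_mulVec_mulVec (v : V2) : Rmat *ᵥ (Rmat *ᵥ v) = -(Rmat *ᵥ v) - v := by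
  have h3 : Real.sqrt 3 ^ 2 = 3 := Real.sq_sqrt (by norm_num)
  ext i
  fin_cases i <;> simp [Rmat, Matrix.mulVec, dotProduct, Fin.sum_univ_two]
  · linear_combination (-v 0 / 4) * h3
  · linear_combination (-v 1 / 4) * h3

theorem Rmat_mulVec_lattice (m n : ℤ) :
    Rmat *ᵥ (m • kv1 + n • kv2) = (-n) • kv1 + (m - n) • kv2 := by
  rw [mulVec_add, mulVec_smul, mulVec_smul, Rmat_mulVec_kv1, Rmat_mulVec_kv2]
  module

theorem Lstar_add {v w : V2} (hv : v ∈ Lstar) (hw : w ∈ Lstar) : v + w ∈ Lstar := by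
  obtain ⟨m, n, rfl⟩ := hv
  obtain ⟨p, q, rfl⟩ := hw
  exact ⟨m + p, n + q, by module⟩

theorem Lstar_neg {v : V2} (hv : v ∈ Lstar) : -v ∈ Lstar := by
  obtain ⟨m, n, rfl⟩ := hv
  exact ⟨-m, -n, by module⟩

theorem Lstar_sub {v w : V2} (hv : v ∈ Lstar) (hw : w ∈ Lstar) : v - w ∈ Lstar :=
  sub_eq_add_neg v w ▸ Lstar_add hv (Lstar_neg hw)

theorem Rmat_mulVec_mem_Lstar {v : V2} (hv : v ∈ Lstar) : Rmat *ᵥ v ∈ Lstar := by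
  obtain ⟨m, n, rfl⟩ := hv
  exact ⟨-n, m - n, Rmat_mulVec_lattice m n⟩

/-- A shifted lattice is `R`-invariant iff `R` moves the shift by a lattice vector. -/
theorem image_shifted_lattice_eq_iff (k : V2) :
    Rmat.mulVec '' {y | ∃ w ∈ Lstar, y = k + w} = {y | ∃ w ∈ Lstar, y = k + w} ↔
      Rmat *ᵥ k - k ∈ Lstar := by
  constructor
  · intro h
    have hk : Rmat *ᵥ k ∈ {y | ∃ w ∈ Lstar, y = k + w} :=
      h ▸ Set.mem_image_of_mem _ ⟨0, ⟨0, 0, by simp⟩, by simp⟩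
    obtain ⟨w, hw, e⟩ := hk
    rwa [e, add_sub_cancel_left]
  · intro h
    ext y
    constructor
    · rintro ⟨_, ⟨w, hw, rfl⟩, rfl⟩
      refine ⟨_, Lstar_add h (Rmat_mulVec_mem_Lstar hw), ?_⟩
      rw [mulVec_add]
      abel
    · rintro ⟨w, hw, rfl⟩
      have hu := Lstar_sub hw h
      refine ⟨_, ⟨_, Lstar_neg (Lstar_add (Rmat_mulVec_mem_Lstar hu) hu), rfl⟩, ?_⟩
      rw [mulVec_add, mulVec_neg, mulVec_add, Rmat_mulVec_mulVec]
      abel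

theorem Rmat_mulVec_sub_mem_Lstar_of_sub_mem {k l : V2} (hl : Rmat *ᵥ l - l ∈ Lstar)
    (h : k - l ∈ Lstar) : Rmat *ᵥ k - k ∈ Lstar := by
  have e : Rmat *ᵥ k - k = (Rmat *ᵥ (k - l) - (k - l)) + (Rmat *ᵥ l - l) := by
    rw [mulVec_sub]
    abel
  rw [e]
  exact Lstar_add (Lstar_sub (Rmat_mulVec_mem_Lstar h) h) hl

theorem Rmat_mulVec_Kpt_sub_mem_Lstar : Rmat *ᵥ Kpt - Kpt ∈ Lstar := by
  have h := congrArg Rmat.mulVec three_smul_Kpt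
  rw [mulVec_smul, mulVec_sub, Rmat_mulVec_kv1, Rmat_mulVec_kv2] at h
  exact ⟨0, 1, by linear_combination (norm := module) (1 / 3 : ℝ) • h - (1 / 3 : ℝ) • three_smul_Kpt⟩

theorem Rmat_mulVec_sub_mem_Lstar_iff (k : V2) :
    Rmat *ᵥ k - k ∈ Lstar ↔ k ∈ Lstar ∨ k - Kpt ∈ Lstar ∨ k + Kpt ∈ Lstar := by
  constructor
  · rintro ⟨p, q, h⟩
    have hR := congrArg Rmat.mulVec h
    rw [mulVec_sub, Rmat_mulVec_mulVec, Rmat_mulVec_lattice] at hR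
    have hk : (3 : ℝ) • k = (q - 2 * p) • kv1 - (p + q) • kv2 := by
      linear_combination (norm := module) (-1 : ℝ) • hR - (2 : ℝ) • h
    have hs : ∃ s : ℤ, p + q = 3 * s ∨ p + q = 3 * s + 1 ∨ p + q = 3 * s - 1 :=
      ⟨(p + q + 1) / 3, by omega⟩
    obtain ⟨s, hs | hs | hs⟩ := hs
    · obtain rfl : q = 3 * s - p := by omega
      exact .inl ⟨s - p, -s, by linear_combination (norm := module) (1 / 3 : ℝ) • hk⟩
    · obtain rfl : q = 3 * s + 1 - p := by omega
      exact .inr (.inl ⟨s - p, -s, by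
        linear_combination (norm := module) (1 / 3 : ℝ) • hk - (1 / 3 : ℝ) • three_smul_Kpt⟩)
    · obtain rfl : q = 3 * s - 1 - p := by omega
      exact .inr (.inr ⟨s - p, -s, by
        linear_combination (norm := module) (1 / 3 : ℝ) • hk + (1 / 3 : ℝ) • three_smul_Kpt⟩)
  · rintro (h | h | h)
    · exact Lstar_sub (Rmat_mulVec_mem_Lstar h) h
    · exact Rmat_mulVec_sub_mem_Lstar_of_sub_mem Rmat_mulVec_Kpt_sub_mem_Lstar h
    · refine Rmat_mulVec_sub_mem_Lstar_of_sub_mem (l := -Kpt) ?_ (by rwa [sub_neg_eq_add])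
      rw [mulVec_neg, ← neg_sub']
      exact Lstar_neg Rmat_mulVec_Kpt_sub_mem_Lstar

/-- `R (k + Λ_h*) = k + Λ_h*` iff `k ≡ 0, K, or -K (mod Λ_h*)`. -/
theorem rotation_invariant_shifted_lattice_iff (k : V2) :
    (Rmat.mulVec '' {y | ∃ w ∈ Lstar, y = k + w} = {y | ∃ w ∈ Lstar, y = k + w}) ↔
      (k ∈ Lstar ∨ k - Kpt ∈ Lstar ∨ k + Kpt ∈ Lstar) := by
  rw [image_shifted_lattice_eq_iff, Rmat_mulVec_sub_mem_Lstar_iff]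
end
end

section
/- Let A : ℝ² → M₂(ℂ) be smooth, Λ_h-periodic, Hermitian-valued, and satisfy A(Rᵀx) = Rᵀ A(x) R for all x. Let K_* ∈ {K, −K}, let τ = e^{2πi/3}, and let Φ₁, Φ₂ : ℝ² → ℂ be smooth K_*-pseudoperiodic functions with Φ₁(Rᵀx) = τ Φ₁(x) and Φ₂(Rᵀx) = conj(τ) Φ₂(x) for all x. Then: (1) ∫_{Ω_h} conj(Φ₁) (𝒜_j Φ₁) dx = 0 and ∫_{Ω_h} conj(Φ₂) (𝒜_j Φ₂) dx = 0 for j = 1, 2; (2) there exists c ∈ ℂ with (∫_{Ω_h} conj(Φ₁)(𝒜₁Φ₂) dx, ∫_{Ω_h} conj(Φ₁)(𝒜₂Φ₂) dx) = c·(1, i), and (∫_{Ω_h} conj(Φ₂)(𝒜₁Φ₁) dx, ∫_{Ω_h} conj(Φ₂)(𝒜₂Φ₁) dx) = conj(c)·(1, −i). -/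
open Matrix MeasureTheory Complex

noncomputable section

abbrev M2 : Type := Matrix (Fin 2) (Fin 2) ℂ

/-- Partial derivative in coordinate direction `i`. -/
noncomputable def pd (i : Fin 2) (f : V2 → ℂ) (x : V2) : ℂ :=
  fderiv ℝ f x (Pi.single i 1)

/-- The divergence-form operator `L^A f = -∑ ∂_i (a_{ij} ∂_j f)`. -/
noncomputable def LA (A : V2 → M2) (f : V2 → ℂ) (x : V2) : ℂ :=
  -∑ i : Fin 2, ∑ j : Fin 2, pd i (fun y => A y i j * pd j f y) x

/-- Lattice basis vector `v₁ = (√3/2, 1/2)`. -/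
def v1 : V2 := ![Real.sqrt 3 / 2, 1 / 2]

/-- Lattice basis vector `v₂ = (√3/2, -1/2)`. -/
def v2 : V2 := ![Real.sqrt 3 / 2, -(1 / 2)]

/-- `Λ_h`-periodicity of a matrix-valued function. -/
def perM (A : V2 → M2) : Prop := ∀ x : V2, ∀ m n : ℤ, A (x + m • v1 + n • v2) = A x

/-- `k`-pseudoperiodicity: `f(x + v) = e^{i k·v} f(x)` for all lattice vectors `v`. -/
def pseudoPer (k : V2) (f : V2 → ℂ) : Prop :=
  ∀ x : V2, ∀ m n : ℤ,
    f (x + m • v1 + n • v2) =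
      Complex.exp (Complex.I * ((k ⬝ᵥ ((m • v1 + n • v2 : V2)) : ℝ) : ℂ)) * f x

/-- The fundamental cell `Ω_h = {t₁ v₁ + t₂ v₂ : 0 ≤ t₁, t₂ ≤ 1}`. -/
def Ωh : Set V2 :=
  {y | ∃ t1 t2 : ℝ, t1 ∈ Set.Icc (0:ℝ) 1 ∧ t2 ∈ Set.Icc (0:ℝ) 1 ∧ y = t1 • v1 + t2 • v2}

/-- Complexification of a real matrix. -/
def cM (O : Matrix (Fin 2) (Fin 2) ℝ) : M2 := O.map (fun t => (t : ℂ))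

/-- `τ = e^{2πi/3}`. -/
noncomputable def τ : ℂ := Complex.exp (2 * Real.pi * Complex.I / 3)

/-- The vector operator 𝒜 associated with `A`. -/
noncomputable def opA (A : V2 → M2) (j : Fin 2) (f : V2 → ℂ) (x : V2) : ℂ :=
  ∑ l : Fin 2,
    (A x j l * (-Complex.I * pd l f x) + (-Complex.I) * pd l (fun y => A y l j * f y) x)

/-- `Λ_h`-periodicity of a scalar function. -/
def LatticePeriodic (F : V2 → ℂ) : Prop := ∀ x : V2, ∀ m n : ℤ, F (x + m • v1 + n • v2) = F x

lemma linearIndependent_v1_v2 : LinearIndependent ℝ ![v1, v2] := by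
  rw [LinearIndependent.pair_iff]
  intro s t h
  have h0 := congrFun h 0
  have h1 := congrFun h 1
  have h3 : (0 : ℝ) < Real.sqrt 3 := by positivity
  simp only [v1, v2, Pi.add_apply, Pi.smul_apply, smul_eq_mul, Pi.zero_apply,
    Matrix.cons_val_zero, Matrix.cons_val_one] at h0 h1
  have hsum : s + t = 0 := by
    have : Real.sqrt 3 * (s + t) = 0 := by linarith
    exact (mul_eq_zero.mp this).resolve_left h3.ne'
  constructor <;> linarith

/-- The lattice basis `(v₁, v₂)`. -/
def latticeBasis : Module.Basis (Fin 2) ℝ V2 :=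
  basisOfLinearIndependentOfCardEqFinrank linearIndependent_v1_v2 (by simp)

lemma coe_latticeBasis : ⇑latticeBasis = ![v1, v2] :=
  coe_basisOfLinearIndependentOfCardEqFinrank _ _

lemma Ωh_eq_parallelepiped : Ωh = parallelepiped latticeBasis := by
  ext y
  rw [mem_parallelepiped_iff]
  constructor
  · rintro ⟨t1, t2, h1, h2, rfl⟩
    refine ⟨![t1, t2], ⟨?_, ?_⟩, by simp [coe_latticeBasis, Fin.sum_univ_two]⟩
    · intro i; fin_cases i; exacts [h1.1, h2.1]
    · intro i; fin_cases i; exacts [h1.2, h2.2]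
  · rintro ⟨t, ht, rfl⟩
    exact ⟨t 0, t 1, ⟨ht.1 0, ht.2 0⟩, ⟨ht.1 1, ht.2 1⟩,
      by simp [coe_latticeBasis, Fin.sum_univ_two]⟩

lemma isCompact_Ωh : IsCompact Ωh := by
  rw [Ωh_eq_parallelepiped]
  exact (Module.Basis.parallelepiped latticeBasis).isCompact

lemma setIntegral_Ωh_eq (F : V2 → ℂ) :
    ∫ x in Ωh, F x = ∫ x in ZSpan.fundamentalDomain latticeBasis, F x := by
  rw [Ωh_eq_parallelepiped]
  exact setIntegral_congr_set (ZSpan.fundamentalDomain_ae_parallelepiped latticeBasis volume).symm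

lemma LatticePeriodic.add_mem_span {F : V2 → ℂ} (hF : LatticePeriodic F)
    (g : Submodule.span ℤ (Set.range latticeBasis)) (x : V2) : F (g +ᵥ x) = F x := by
  obtain ⟨g, hg⟩ := g
  rw [coe_latticeBasis, Matrix.range_cons, Matrix.range_cons, Matrix.range_empty,
    Set.union_empty, Set.singleton_union, Submodule.mem_span_pair] at hg
  obtain ⟨m, n, rfl⟩ := hg
  rw [← hF x m n, Submodule.vadd_def, vadd_eq_add, add_comm, add_assoc]

lemma LatticePeriodic.setIntegral_Ωh_eq_of_isAddFundamentalDomain {F : V2 → ℂ}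
    (hF : LatticePeriodic F) {D : Set V2}
    (hD : IsAddFundamentalDomain (Submodule.span ℤ (Set.range latticeBasis)) D) :
    ∫ x in Ωh, F x = ∫ x in D, F x := by
  rw [setIntegral_Ωh_eq]
  have : VAddInvariantMeasure (Submodule.span ℤ (Set.range latticeBasis)) V2 volume :=
    inferInstanceAs <|
      VAddInvariantMeasure (Submodule.span ℤ (Set.range latticeBasis)).toAddSubgroup V2 volume
  exact IsAddFundamentalDomain.setIntegral_eq (ZSpan.isAddFundamentalDomain latticeBasis volume) hD
    hF.add_mem_span

lemma LatticePeriodic.comp_add {F : V2 → ℂ} (hF : LatticePeriodic F) (w : V2) :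
    LatticePeriodic fun x => F (x + w) := fun x m n => by
  simp only [← hF (x + w) m n, add_right_comm _ w]

lemma LatticePeriodic.setIntegral_add {F : V2 → ℂ} (hF : LatticePeriodic F) (w : V2) :
    ∫ x in Ωh, F (x + w) = ∫ x in Ωh, F x := by
  have hw : MeasurePreserving (fun x : V2 => x + w) := measurePreserving_add_right volume w
  rw [LatticePeriodic.setIntegral_Ωh_eq_of_isAddFundamentalDomain (F := fun x => F (x + w))
    (D := (fun x : V2 => x + w) ⁻¹' ZSpan.fundamentalDomain latticeBasis) (hF.comp_add w),
    setIntegral_Ωh_eq]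
  · exact hw.setIntegral_preimage_emb (measurableEmbedding_addRight w) F _
  · refine (ZSpan.isAddFundamentalDomain latticeBasis volume).preimage_of_equiv
      hw.quasiMeasurePreserving Function.bijective_id fun g x => ?_
    simp only [id, Submodule.vadd_def, vadd_eq_add, add_assoc]

lemma sqrt_three_mul_self : Real.sqrt 3 * Real.sqrt 3 = 3 :=
  Real.mul_self_sqrt (by norm_num)

lemma Rmat_transpose_eq :
    Rmatᵀ = !![-1/2, -Real.sqrt 3/2; Real.sqrt 3/2, -1/2] := by
  ext i j
  fin_cases i <;> fin_cases j <;> rfl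

lemma det_Rmat_transpose : (Rmatᵀ).det = 1 := by
  rw [Rmat_transpose_eq, Matrix.det_fin_two_of]
  linarith [sqrt_three_mul_self]

/-- Rotation by `2π/3` as a linear automorphism of the plane. -/
def rotEquiv : V2 ≃ₗ[ℝ] V2 :=
  Matrix.toLinearEquiv' Rmatᵀ (Matrix.invertibleOfIsUnitDet _ (by rw [det_Rmat_transpose]; exact isUnit_one))

lemma rotEquiv_apply (x : V2) : rotEquiv x = Rmatᵀ.mulVec x := rfl

lemma rotEquiv_v1 : rotEquiv v1 = -v2 := by
  rw [rotEquiv_apply, Rmat_transpose_eq]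
  ext i
  fin_cases i <;> simp [v1, v2, Matrix.mulVec, dotProduct, Fin.sum_univ_two] <;>
    nlinarith [sqrt_three_mul_self]

lemma rotEquiv_v2 : rotEquiv v2 = v1 - v2 := by
  rw [rotEquiv_apply, Rmat_transpose_eq]
  ext i
  fin_cases i <;> simp [v1, v2, Matrix.mulVec, dotProduct, Fin.sum_univ_two] <;>
    nlinarith [sqrt_three_mul_self]

lemma measurePreserving_rotEquiv : MeasurePreserving rotEquiv := by
  refine ⟨(LinearMap.continuous_of_finiteDimensional rotEquiv.toLinearMap).measurable, ?_⟩
  have h := Real.map_matrix_volume_pi_eq_smul_volume_pi (M := Rmatᵀ) (by rw [det_Rmat_transpose]; exact one_ne_zero)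
  rw [det_Rmat_transpose, inv_one, abs_one, ENNReal.ofReal_one, one_smul] at h
  exact h

lemma span_range_map_rotEquiv :
    Submodule.span ℤ (Set.range (latticeBasis.map rotEquiv)) =
      Submodule.span ℤ (Set.range latticeBasis) := by
  have h : ⇑(latticeBasis.map rotEquiv) = ![-v2, v1 - v2] := by
    ext1 i
    fin_cases i <;> simp [coe_latticeBasis, rotEquiv_v1, rotEquiv_v2]
  rw [h, coe_latticeBasis]
  simp only [Matrix.range_cons, Matrix.range_empty, Set.union_empty, Set.singleton_union]
  apply le_antisymm <;> rw [Submodule.span_le] <;> rintro x (rfl | rfl) <;>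
    rw [SetLike.mem_coe, Submodule.mem_span_pair]
  · exact ⟨0, -1, by simp⟩
  · exact ⟨1, -1, by simp [sub_eq_add_neg]⟩
  · exact ⟨-1, 1, by simp⟩
  · exact ⟨-1, 0, by simp⟩

lemma LatticePeriodic.setIntegral_rot {F : V2 → ℂ} (hF : LatticePeriodic F) :
    ∫ x in Ωh, F (Rmatᵀ.mulVec x) = ∫ x in Ωh, F x := by
  have hD := ZSpan.isAddFundamentalDomain (latticeBasis.map rotEquiv) volume
  rw [span_range_map_rotEquiv, ← ZSpan.map_fundamentalDomain] at hD
  rw [hF.setIntegral_Ωh_eq_of_isAddFundamentalDomain hD, setIntegral_Ωh_eq]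
  exact (measurePreserving_rotEquiv.setIntegral_image_emb
    rotEquiv.toContinuousLinearEquiv.toHomeomorph.measurableEmbedding F _).symm

lemma LatticePeriodic.fderiv_apply {G : V2 → ℂ} (hG : LatticePeriodic G) (w : V2) :
    LatticePeriodic fun x => fderiv ℝ G x w := fun x m n => by
  have h : (fun y => G (y + (m • v1 + n • v2))) = G := by
    ext y
    rw [← add_assoc, hG]
  simp only [add_assoc, ← fderiv_comp_add_right, h]

lemma integrableOn_Ωh {F : V2 → ℂ} (hF : Continuous F) : IntegrableOn F Ωh :=
  hF.continuousOn.integrableOn_compact isCompact_Ωh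

lemma LatticePeriodic.setIntegral_fderiv {G : V2 → ℂ} (hG : LatticePeriodic G)
    (hsm : ContDiff ℝ 1 G) (w : V2) : ∫ x in Ωh, fderiv ℝ G x w = 0 := by
  have hc : Continuous fun x => fderiv ℝ G x w := hsm.continuous_fderiv_apply one_ne_zero |>.comp
    (by fun_prop : Continuous fun x : V2 => (x, w))
  have hline : ∀ x : V2, ∫ s in (0 : ℝ)..1, fderiv ℝ G (x + s • w) w = G (x + w) - G x := by
    intro x
    have hd : ∀ s : ℝ, HasDerivAt (fun s : ℝ => G (x + s • w)) (fderiv ℝ G (x + s • w) w) s := by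
      intro s
      have h1 : HasDerivAt (fun s : ℝ => x + s • w) w s := by
        simpa using ((hasDerivAt_id s).smul_const w).const_add x
      exact (hsm.differentiable one_ne_zero (x + s • w)).hasFDerivAt.comp_hasDerivAt s h1
    rw [intervalIntegral.integral_eq_sub_of_hasDerivAt (fun s _ => hd s)
      ((hc.comp (by fun_prop)).intervalIntegrable _ _)]
    simp
  have hprod : Integrable (Function.uncurry fun (s : ℝ) (x : V2) => fderiv ℝ G (x + s • w) w)
      ((volume.restrict (Set.uIoc (0 : ℝ) 1)).prod (volume.restrict Ωh)) := by
    rw [Measure.prod_restrict]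
    have hcont : Continuous (Function.uncurry fun (s : ℝ) (x : V2) => fderiv ℝ G (x + s • w) w) :=
      hc.comp (by fun_prop : Continuous fun p : ℝ × V2 => p.2 + p.1 • w)
    refine (hcont.continuousOn.integrableOn_compact
      ((isCompact_Icc (a := (0 : ℝ)) (b := 1)).prod isCompact_Ωh)).mono_set (Set.prod_mono ?_ subset_rfl)
    · exact Set.uIoc_subset_uIcc.trans (Set.uIcc_of_le zero_le_one).subset
  calc ∫ x in Ωh, fderiv ℝ G x w
      = ∫ s in (0 : ℝ)..1, ∫ x in Ωh, fderiv ℝ G (x + s • w) w := by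
        simp [(hG.fderiv_apply w).setIntegral_add]
    _ = ∫ x in Ωh, ∫ s in (0 : ℝ)..1, fderiv ℝ G (x + s • w) w :=
        intervalIntegral_integral_swap hprod
    _ = ∫ x in Ωh, (G (x + w) - G x) := by simp only [hline]
    _ = 0 := by
        have hi := integrableOn_Ωh hsm.continuous
        have hi' : IntegrableOn (fun x => G (x + w)) Ωh :=
          integrableOn_Ωh (hsm.continuous.comp (by fun_prop))
        rw [integral_sub hi' hi,
          hG.setIntegral_add, sub_self]

lemma pd_comp_add (i : Fin 2) (f : V2 → ℂ) (v x : V2) :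
    pd i (fun y => f (y + v)) x = pd i f (x + v) := by
  simp only [pd, fderiv_comp_add_right]

lemma pd_const_mul (i : Fin 2) (c : ℂ) {f : V2 → ℂ} (hf : Differentiable ℝ f) (x : V2) :
    pd i (fun y => c * f y) x = c * pd i f x := by
  simp only [pd, fderiv_const_mul (hf x), _root_.smul_apply, smul_eq_mul]

lemma pd_add (i : Fin 2) {f g : V2 → ℂ} (hf : Differentiable ℝ f) (hg : Differentiable ℝ g)
    (x : V2) : pd i (fun y => f y + g y) x = pd i f x + pd i g x := by
  simp only [pd, fderiv_fun_add (hf x) (hg x), _root_.add_apply]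

lemma pd_mul (i : Fin 2) {f g : V2 → ℂ} (hf : Differentiable ℝ f) (hg : Differentiable ℝ g)
    (x : V2) : pd i (fun y => f y * g y) x = f x * pd i g x + pd i f x * g x := by
  simp only [pd, fderiv_fun_mul (hf x) (hg x), _root_.add_apply,
    _root_.smul_apply, smul_eq_mul, mul_comm (g x)]

lemma pd_conj (i : Fin 2) {f : V2 → ℂ} (hf : Differentiable ℝ f) (x : V2) :
    pd i (fun y => starRingEnd ℂ (f y)) x = starRingEnd ℂ (pd i f x) := by
  have h := (Complex.conjCLE.toContinuousLinearMap.hasFDerivAt.comp x (hf x).hasFDerivAt).fderiv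
  exact congrArg (fun L => L (Pi.single i 1)) h

lemma continuous_pd (i : Fin 2) {f : V2 → ℂ} (hf : ContDiff ℝ 1 f) : Continuous (pd i f) :=
  (hf.continuous_fderiv_apply one_ne_zero).comp
    (by fun_prop : Continuous fun x : V2 => (x, (Pi.single i 1 : V2)))

lemma Rmat_transpose_entries : Rmatᵀ 0 0 = -1/2 ∧ Rmatᵀ 0 1 = -Real.sqrt 3/2 ∧
    Rmatᵀ 1 0 = Real.sqrt 3/2 ∧ Rmatᵀ 1 1 = -1/2 := ⟨rfl, rfl, rfl, rfl⟩

lemma pd_rot (l : Fin 2) {f : V2 → ℂ} (hf : Differentiable ℝ f) (x : V2) :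
    pd l f (Rmatᵀ.mulVec x) = ∑ m, (Rmatᵀ l m : ℂ) * pd m (fun y => f (Rmatᵀ.mulVec y)) x := by
  have h : ∀ m, pd m (fun y => f (Rmatᵀ.mulVec y)) x =
      ∑ i, (Rmatᵀ i m : ℂ) * pd i f (Rmatᵀ.mulVec x) := by
    intro m
    have h1 := ((hf (Rmatᵀ.mulVec x)).hasFDerivAt.comp x
      ((Matrix.mulVecLin Rmatᵀ).toContinuousLinearMap.hasFDerivAt)).fderiv
    have h2 : Rmatᵀ.mulVec (Pi.single m 1) =
        ∑ i, Rmatᵀ i m • (Pi.single i 1 : V2) := by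
      ext i
      fin_cases i <;> simp [Fin.sum_univ_two]
    have h3 : pd m (fun y => f (Rmatᵀ.mulVec y)) x =
        fderiv ℝ f (Rmatᵀ.mulVec x) (Rmatᵀ.mulVec (Pi.single m 1)) :=
      congrArg (fun L => L (Pi.single m 1)) h1
    rw [h3, h2, map_sum]
    simp only [map_smul, pd, Complex.real_smul]
  have h3 : (Real.sqrt 3 : ℂ) * Real.sqrt 3 = 3 := by exact_mod_cast sqrt_three_mul_self
  obtain ⟨h00, h01, h10, h11⟩ := Rmat_transpose_entries
  fin_cases l <;> simp only [h, Fin.sum_univ_two, Fin.zero_eta, Fin.mk_one, h00, h01, h10, h11] <;>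
    push_cast
  · linear_combination (-1/4) * pd 0 f (Rmatᵀ.mulVec x) * h3
  · linear_combination (-1/4) * pd 1 f (Rmatᵀ.mulVec x) * h3

lemma conj_exp_mul_exp (t : ℝ) :
    starRingEnd ℂ (Complex.exp (Complex.I * (t : ℂ))) * Complex.exp (Complex.I * (t : ℂ)) = 1 := by
  rw [← Complex.exp_conj, ← Complex.exp_add]
  simp

section OperatorA

variable {A : V2 → M2} {f g : V2 → ℂ}

lemma continuous_opA (hA : ∀ i j, ContDiff ℝ 1 fun x => A x i j) (hf : ContDiff ℝ 1 f)
    (j : Fin 2) : Continuous (opA A j f) := by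
  refine continuous_finsetSum _ fun l _ => ?_
  exact ((hA j l).continuous.mul (continuous_const.mul (continuous_pd l hf))).add
    (continuous_const.mul (continuous_pd l ((hA l j).mul hf)))

lemma opA_add_eq_mul (hA : ∀ i j, Differentiable ℝ fun x => A x i j) (hf : Differentiable ℝ f)
    {v : V2} {c : ℂ} (hAv : ∀ x, A (x + v) = A x) (hfv : ∀ x, f (x + v) = c * f x)
    (j : Fin 2) (x : V2) : opA A j f (x + v) = c * opA A j f x := by
  have h : ∀ l, pd l (fun y => A y l j * (c * f y)) x = c * pd l (fun y => A y l j * f y) x := by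
    intro l
    have hd : Differentiable ℝ fun y => A y l j * f y := (hA l j).mul hf
    simp only [← pd_const_mul l c hd, mul_left_comm]
  simp only [opA, ← pd_comp_add, hAv, hfv, h, pd_const_mul _ c hf, Fin.sum_univ_two]
  ring

lemma latticePeriodic_conj_mul_opA (hA : ∀ i j, Differentiable ℝ fun x => A x i j)
    (hper : perM A) (hg : Differentiable ℝ g) {k : V2} (hfk : pseudoPer k f)
    (hgk : pseudoPer k g) (j : Fin 2) :
    LatticePeriodic fun x => starRingEnd ℂ (f x) * opA A j g x := by
  intro x m n
  simp only
  rw [hfk x m n, add_assoc x, opA_add_eq_mul hA hg (v := m • v1 + n • v2)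
    (fun y => by rw [← add_assoc, hper]) (fun y => by rw [← add_assoc, hgk])]
  have h := conj_exp_mul_exp (k ⬝ᵥ ((m • v1 + n • v2 : V2)))
  rw [map_mul]
  linear_combination (starRingEnd ℂ (f x) * opA A j g x) * h

lemma latticePeriodic_conj_mul_mul (hper : perM A) {k : V2} (hfk : pseudoPer k f)
    (hgk : pseudoPer k g) (i j : Fin 2) :
    LatticePeriodic fun x => starRingEnd ℂ (f x) * (A x i j * g x) := by
  intro x m n
  simp only
  rw [hfk x m n, hper, hgk x m n, map_mul]
  have h := conj_exp_mul_exp (k ⬝ᵥ ((m • v1 + n • v2 : V2)))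
  linear_combination (starRingEnd ℂ (f x) * A x i j * g x) * h

lemma conj_mul_opA_sub_conj (hA : ∀ i j, Differentiable ℝ fun x => A x i j)
    (hherm : ∀ x, (A x).IsHermitian) (hf : Differentiable ℝ f) (hg : Differentiable ℝ g)
    (j : Fin 2) (x : V2) :
    starRingEnd ℂ (f x) * opA A j g x - starRingEnd ℂ (starRingEnd ℂ (g x) * opA A j f x) =
      -Complex.I * ∑ l, (pd l (fun y => starRingEnd ℂ (f y) * (A y l j * g y)) x +
        pd l (fun y => starRingEnd ℂ (f y) * (A y j l * g y)) x) := by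
  have hcA : ∀ i k y, starRingEnd ℂ (A y i k) = A y k i := fun i k y => (hherm y).apply k i
  have hcf : Differentiable ℝ fun y => starRingEnd ℂ (f y) :=
    Complex.conjCLE.differentiable.comp hf
  have h1 : ∀ l, pd l (fun y => starRingEnd ℂ (f y) * (A y l j * g y)) x =
      starRingEnd ℂ (f x) * pd l (fun y => A y l j * g y) x +
        starRingEnd ℂ (pd l f x) * (A x l j * g x) := by
    intro l
    rw [← pd_conj l hf]
    exact pd_mul l hcf ((hA l j).mul hg) x
  have h2 : ∀ l, pd l (fun y => starRingEnd ℂ (f y) * (A y j l * g y)) x =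
      starRingEnd ℂ (pd l (fun y => A y l j * f y) x) * g x +
        starRingEnd ℂ (f x) * A x j l * pd l g x := by
    intro l
    rw [← pd_conj l (f := fun y => A y l j * f y) ((hA l j).mul hf)]
    have := pd_mul l (f := fun y => A y j l * starRingEnd ℂ (f y)) ((hA j l).mul hcf) hg x
    simp only [map_mul, hcA]
    rw [show (fun y => starRingEnd ℂ (f y) * (A y j l * g y)) =
      fun y => A y j l * starRingEnd ℂ (f y) * g y by ext y; ring, this]
    ring
  simp only [h1, h2, opA, Fin.sum_univ_two, map_add, map_mul, hcA, map_neg, Complex.conj_I,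
    Complex.conj_conj]
  ring

lemma setIntegral_conj_mul_opA_symm (hA : ∀ i j, ContDiff ℝ 1 fun x => A x i j)
    (hper : perM A) (hherm : ∀ x, (A x).IsHermitian) (hf : ContDiff ℝ 1 f) (hg : ContDiff ℝ 1 g)
    {k : V2} (hfk : pseudoPer k f) (hgk : pseudoPer k g) (j : Fin 2) :
    ∫ x in Ωh, starRingEnd ℂ (g x) * opA A j f x =
      starRingEnd ℂ (∫ x in Ωh, starRingEnd ℂ (f x) * opA A j g x) := by
  have hcf : ContDiff ℝ 1 fun y => starRingEnd ℂ (f y) := Complex.conjCLE.contDiff.comp hf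
  have hcg : ContDiff ℝ 1 fun y => starRingEnd ℂ (g y) := Complex.conjCLE.contDiff.comp hg
  have hsm : ∀ i l, ContDiff ℝ 1 fun y => starRingEnd ℂ (f y) * (A y i l * g y) :=
    fun i l => hcf.mul ((hA i l).mul hg)
  have hint : ∀ m i l, IntegrableOn (pd m fun y => starRingEnd ℂ (f y) * (A y i l * g y)) Ωh :=
    fun m i l => integrableOn_Ωh (continuous_pd m (hsm i l))
  have hzero : ∀ m i l, ∫ x in Ωh, pd m (fun y => starRingEnd ℂ (f y) * (A y i l * g y)) x = 0 :=
    fun m i l => (latticePeriodic_conj_mul_mul hper hfk hgk i l).setIntegral_fderiv (hsm i l) _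
  have hdiff : ∫ x in Ωh, (starRingEnd ℂ (f x) * opA A j g x -
      starRingEnd ℂ (starRingEnd ℂ (g x) * opA A j f x)) = 0 := by
    simp only [conj_mul_opA_sub_conj (fun i j => (hA i j).differentiable one_ne_zero) hherm
      (hf.differentiable one_ne_zero) (hg.differentiable one_ne_zero)]
    have hint' : ∀ l, IntegrableOn (fun x =>
        pd l (fun y => starRingEnd ℂ (f y) * (A y l j * g y)) x +
          pd l (fun y => starRingEnd ℂ (f y) * (A y j l * g y)) x) Ωh :=
      fun l => (hint l l j).add (hint l j l)
    rw [integral_const_mul, integral_finsetSum _ fun l _ => hint' l]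
    simp only [integral_add (hint _ _ j) (hint _ j _), hzero, add_zero, Finset.sum_const_zero,
      mul_zero]
  have hi₁ : IntegrableOn (fun x => starRingEnd ℂ (f x) * opA A j g x) Ωh :=
    integrableOn_Ωh (hcf.continuous.mul (continuous_opA hA hg j))
  have hi₂ : IntegrableOn (fun x => starRingEnd ℂ (starRingEnd ℂ (g x) * opA A j f x)) Ωh :=
    integrableOn_Ωh (Complex.continuous_conj.comp
      (hcg.continuous.mul (continuous_opA hA hf j)))
  rw [integral_sub hi₁ hi₂, integral_conj, sub_eq_zero] at hdiff
  rw [hdiff, Complex.conj_conj]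

lemma opA_rot (hA : ∀ i j, Differentiable ℝ fun x => A x i j) (hf : Differentiable ℝ f)
    (hrot : ∀ x : V2, A (Rmatᵀ.mulVec x) = (cM Rmat)ᵀ * A x * cM Rmat) {β : ℂ}
    (hfr : ∀ x : V2, f (Rmatᵀ.mulVec x) = β * f x) (j : Fin 2) (x : V2) :
    opA A j f (Rmatᵀ.mulVec x) = β * ∑ m, (Rmatᵀ j m : ℂ) * opA A m f x := by
  have hent : ∀ y l j, A (Rmatᵀ.mulVec y) l j =
      ∑ p, ∑ q, (Rmatᵀ l p : ℂ) * (Rmatᵀ j q : ℂ) * A y p q := by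
    intro y l j
    simp only [hrot, Matrix.mul_apply, cM, Matrix.transpose_apply, Matrix.map_apply,
      Fin.sum_univ_two]
    ring
  have hd : ∀ p q, Differentiable ℝ fun y => A y p q * f y := fun p q => (hA p q).mul hf
  have hprod : ∀ l, pd l (fun y => A y l j * f y) (Rmatᵀ.mulVec x) =
      ∑ m, (Rmatᵀ l m : ℂ) * (β * ∑ p, ∑ q, (Rmatᵀ l p : ℂ) * (Rmatᵀ j q : ℂ) *
        pd m (fun y => A y p q * f y) x) := by
    intro l
    rw [pd_rot l (hd l j)]
    refine Finset.sum_congr rfl fun m _ => ?_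
    congr 1
    have hfun : (fun y => A (Rmatᵀ.mulVec y) l j * f (Rmatᵀ.mulVec y)) = fun y =>
        β * (((Rmatᵀ l 0 : ℂ) * (Rmatᵀ j 0 : ℂ) * (A y 0 0 * f y) +
          (Rmatᵀ l 0 : ℂ) * (Rmatᵀ j 1 : ℂ) * (A y 0 1 * f y)) +
          ((Rmatᵀ l 1 : ℂ) * (Rmatᵀ j 0 : ℂ) * (A y 1 0 * f y) +
          (Rmatᵀ l 1 : ℂ) * (Rmatᵀ j 1 : ℂ) * (A y 1 1 * f y))) := by
      ext y
      rw [hent, hfr]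
      simp only [Fin.sum_univ_two]
      ring
    have hc : ∀ (c : ℂ) (p q), Differentiable ℝ fun y => c * (A y p q * f y) :=
      fun c p q => (hd p q).const_mul c
    rw [hfun, pd_const_mul m β (((hc _ 0 0).fun_add (hc _ 0 1)).fun_add
        ((hc _ 1 0).fun_add (hc _ 1 1))),
      pd_add m ((hc _ 0 0).fun_add (hc _ 0 1)) ((hc _ 1 0).fun_add (hc _ 1 1)),
      pd_add m (hc _ 0 0) (hc _ 0 1), pd_add m (hc _ 1 0) (hc _ 1 1)]
    simp only [pd_const_mul m _ (hd _ _), Fin.sum_univ_two]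
  have hder : ∀ l, pd l f (Rmatᵀ.mulVec x) = ∑ m, (Rmatᵀ l m : ℂ) * (β * pd m f x) := by
    intro l
    rw [pd_rot l hf]
    simp only [hfr, pd_const_mul _ β hf]
  have horth : ∀ m p, (Rmatᵀ 0 m : ℂ) * Rmatᵀ 0 p + Rmatᵀ 1 m * Rmatᵀ 1 p =
      if m = p then 1 else 0 := by
    have h3 : (Real.sqrt 3 : ℂ) * Real.sqrt 3 = 3 := by exact_mod_cast sqrt_three_mul_self
    obtain ⟨h00, h01, h10, h11⟩ := Rmat_transpose_entries
    intro m p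
    fin_cases m <;> fin_cases p <;>
      simp only [Fin.zero_eta, Fin.mk_one, h00, h01, h10, h11, if_true, zero_ne_one, one_ne_zero,
        if_false] <;> push_cast
    · linear_combination (1/4) * h3
    · ring
    · ring
    · linear_combination (1/4) * h3
  have h00 := horth 0 0
  have h01 := horth 0 1
  have h10 := horth 1 0
  have h11 := horth 1 1
  simp only [if_true, zero_ne_one, one_ne_zero, if_false] at h00 h01 h10 h11
  simp only [opA, hprod, hder, hent, Fin.sum_univ_two]
  linear_combination
    (-Complex.I * β *
      ((Rmatᵀ j 0 : ℂ) * (pd 0 (fun y => A y 0 0 * f y) x + A x 0 0 * pd 0 f x) +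
        (Rmatᵀ j 1 : ℂ) * (pd 0 (fun y => A y 0 1 * f y) x + A x 1 0 * pd 0 f x))) * h00 +
    (-Complex.I * β *
      ((Rmatᵀ j 0 : ℂ) * (pd 0 (fun y => A y 1 0 * f y) x + A x 0 1 * pd 0 f x) +
        (Rmatᵀ j 1 : ℂ) * (pd 0 (fun y => A y 1 1 * f y) x + A x 1 1 * pd 0 f x))) * h01 +
    (-Complex.I * β *
      ((Rmatᵀ j 0 : ℂ) * (pd 1 (fun y => A y 0 0 * f y) x + A x 0 0 * pd 1 f x) +
        (Rmatᵀ j 1 : ℂ) * (pd 1 (fun y => A y 0 1 * f y) x + A x 1 0 * pd 1 f x))) * h10 +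
    (-Complex.I * β *
      ((Rmatᵀ j 0 : ℂ) * (pd 1 (fun y => A y 1 0 * f y) x + A x 0 1 * pd 1 f x) +
        (Rmatᵀ j 1 : ℂ) * (pd 1 (fun y => A y 1 1 * f y) x + A x 1 1 * pd 1 f x))) * h11

lemma setIntegral_conj_mul_opA_rot (hA : ∀ i j, ContDiff ℝ 1 fun x => A x i j)
    (hper : perM A) (hrot : ∀ x : V2, A (Rmatᵀ.mulVec x) = (cM Rmat)ᵀ * A x * cM Rmat)
    (hf : ContDiff ℝ 1 f) (hg : ContDiff ℝ 1 g) {k : V2} (hfk : pseudoPer k f)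
    (hgk : pseudoPer k g) {α β : ℂ} (hfr : ∀ x : V2, f (Rmatᵀ.mulVec x) = α * f x)
    (hgr : ∀ x : V2, g (Rmatᵀ.mulVec x) = β * g x) (j : Fin 2) :
    ∫ x in Ωh, starRingEnd ℂ (f x) * opA A j g x = starRingEnd ℂ α * β *
      ∑ m, (Rmatᵀ j m : ℂ) * ∫ x in Ωh, starRingEnd ℂ (f x) * opA A m g x := by
  have hd : ∀ i j, Differentiable ℝ fun x => A x i j :=
    fun i j => (hA i j).differentiable one_ne_zero
  have hdg := hg.differentiable one_ne_zero
  have hi : ∀ m, IntegrableOn (fun x => starRingEnd ℂ (f x) * opA A m g x) Ωh := fun m =>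
    integrableOn_Ωh ((Complex.continuous_conj.comp hf.continuous).mul (continuous_opA hA hg m))
  rw [← (latticePeriodic_conj_mul_opA hd hper hdg hfk hgk j).setIntegral_rot]
  simp only [← integral_const_mul]
  rw [← integral_finsetSum _ fun m _ => (hi m).const_mul _, ← integral_const_mul]
  congr 1
  ext x
  rw [hfr, opA_rot hd hdg hrot hgr]
  simp only [map_mul, Fin.sum_univ_two]
  ring

end OperatorA

lemma τ_eq : τ = -1 / 2 + Real.sqrt 3 / 2 * Complex.I := by
  have h : (2 * Real.pi * Complex.I / 3 : ℂ) = ((Real.pi - Real.pi / 3 : ℝ) : ℂ) * Complex.I := by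
    push_cast
    ring
  rw [τ, h, Complex.exp_mul_I, ← Complex.ofReal_cos, ← Complex.ofReal_sin, Real.cos_pi_sub,
    Real.sin_pi_sub, Real.cos_pi_div_three, Real.sin_pi_div_three]
  push_cast
  ring

lemma conj_τ : starRingEnd ℂ τ = -1 / 2 - Real.sqrt 3 / 2 * Complex.I := by
  have h2 : starRingEnd ℂ 2 = 2 := map_ofNat _ 2
  simp [τ_eq, sub_eq_add_neg, h2]

lemma conj_τ_mul_τ : starRingEnd ℂ τ * τ = 1 := by
  have h3 : (Real.sqrt 3 : ℂ) * Real.sqrt 3 = 3 := by exact_mod_cast sqrt_three_mul_self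
  rw [conj_τ, τ_eq]
  linear_combination (1/4) * h3 - (Real.sqrt 3 : ℂ) ^ 2 / 4 * Complex.I_mul_I

lemma conj_τ_mul_conj_τ : starRingEnd ℂ τ * starRingEnd ℂ τ = τ := by
  have h3 : (Real.sqrt 3 : ℂ) * Real.sqrt 3 = 3 := by exact_mod_cast sqrt_three_mul_self
  rw [conj_τ, τ_eq]
  linear_combination (-1/4) * h3 + (Real.sqrt 3 : ℂ) ^ 2 / 4 * Complex.I_mul_I

lemma eq_zero_of_rot_invariant {u : Fin 2 → ℂ} (h : ∀ j, u j = ∑ m, (Rmatᵀ j m : ℂ) * u m)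
    (j : Fin 2) : u j = 0 := by
  have h3 : (Real.sqrt 3 : ℂ) * Real.sqrt 3 = 3 := by exact_mod_cast sqrt_three_mul_self
  have h0 := h 0
  have h1 := h 1
  obtain ⟨e00, e01, e10, e11⟩ := Rmat_transpose_entries
  simp only [Fin.sum_univ_two, e00, e01, e10, e11] at h0 h1
  push_cast at h0 h1
  fin_cases j
  · simp only [Fin.zero_eta]
    linear_combination (1/2) * h0 - (Real.sqrt 3 : ℂ) / 6 * h1 - (1/12) * u 0 * h3
  · simp only [Fin.mk_one]
    linear_combination (1/2) * h1 + (Real.sqrt 3 : ℂ) / 6 * h0 - (1/12) * u 1 * h3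

lemma eq_mul_I_of_rot_eigenvector {u : Fin 2 → ℂ}
    (h : ∀ j, u j = τ * ∑ m, (Rmatᵀ j m : ℂ) * u m) : u 1 = u 0 * Complex.I := by
  have h3 : (Real.sqrt 3 : ℂ) * Real.sqrt 3 = 3 := by exact_mod_cast sqrt_three_mul_self
  have hI := Complex.I_mul_I
  have h0 := h 0
  obtain ⟨e00, e01, e10, e11⟩ := Rmat_transpose_entries
  simp only [Fin.sum_univ_two, e00, e01, τ_eq] at h0
  push_cast at h0
  have hne : (3 + Real.sqrt 3 * Complex.I : ℂ) ≠ 0 := by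
    intro h
    simpa using congrArg Complex.re h
  apply mul_left_cancel₀ hne
  linear_combination (-4 * Complex.I) * h0 - u 1 * h3 + u 1 * (Real.sqrt 3 : ℂ) ^ 2 * hI

/-- diagonal matrix elements of 𝒜 in the rotation-eigenbasis vanish, and the
off-diagonal ones are proportional to `(1, i)` resp. `(1, -i)`. -/
theorem opA_matrix_elements (A : V2 → M2)
    (hsm : ∀ i j, ContDiff ℝ (⊤ : ℕ∞) fun x => A x i j)
    (hper : perM A)
    (hherm : ∀ x : V2, (A x).IsHermitian)
    (hrot : ∀ x : V2, A (Rmatᵀ.mulVec x) = (cM Rmat)ᵀ * A x * cM Rmat)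
    (Kstar : V2) (hK : Kstar = Kpt ∨ Kstar = -Kpt)
    (Φ₁ Φ₂ : V2 → ℂ)
    (h1sm : ContDiff ℝ (⊤ : ℕ∞) Φ₁) (h2sm : ContDiff ℝ (⊤ : ℕ∞) Φ₂)
    (h1p : pseudoPer Kstar Φ₁) (h2p : pseudoPer Kstar Φ₂)
    (h1r : ∀ x : V2, Φ₁ (Rmatᵀ.mulVec x) = τ * Φ₁ x)
    (h2r : ∀ x : V2, Φ₂ (Rmatᵀ.mulVec x) = starRingEnd ℂ τ * Φ₂ x) :
    (∀ j : Fin 2, (∫ x in Ωh, starRingEnd ℂ (Φ₁ x) * opA A j Φ₁ x) = 0) ∧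
    (∀ j : Fin 2, (∫ x in Ωh, starRingEnd ℂ (Φ₂ x) * opA A j Φ₂ x) = 0) ∧
    (∃ c : ℂ,
      (∫ x in Ωh, starRingEnd ℂ (Φ₁ x) * opA A 0 Φ₂ x) = c ∧
      (∫ x in Ωh, starRingEnd ℂ (Φ₁ x) * opA A 1 Φ₂ x) = c * Complex.I ∧
      (∫ x in Ωh, starRingEnd ℂ (Φ₂ x) * opA A 0 Φ₁ x) = starRingEnd ℂ c ∧
      (∫ x in Ωh, starRingEnd ℂ (Φ₂ x) * opA A 1 Φ₁ x) = starRingEnd ℂ c * (-Complex.I)) := by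
  have hA : ∀ i j, ContDiff ℝ 1 fun x => A x i j := fun i j => (hsm i j).of_le (by simp)
  have h1 : ContDiff ℝ 1 Φ₁ := h1sm.of_le (by simp)
  have h2 : ContDiff ℝ 1 Φ₂ := h2sm.of_le (by simp)
  refine ⟨fun j => ?_, fun j => ?_, ∫ x in Ωh, starRingEnd ℂ (Φ₁ x) * opA A 0 Φ₂ x, rfl, ?_⟩
  · refine eq_zero_of_rot_invariant
      (u := fun j => ∫ x in Ωh, starRingEnd ℂ (Φ₁ x) * opA A j Φ₁ x) (fun i => ?_) j
    simpa only [conj_τ_mul_τ, one_mul] using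
      setIntegral_conj_mul_opA_rot hA hper hrot h1 h1 h1p h1p h1r h1r i
  · refine eq_zero_of_rot_invariant
      (u := fun j => ∫ x in Ωh, starRingEnd ℂ (Φ₂ x) * opA A j Φ₂ x) (fun i => ?_) j
    simpa only [Complex.conj_conj, mul_comm τ, conj_τ_mul_τ, one_mul] using
      setIntegral_conj_mul_opA_rot hA hper hrot h2 h2 h2p h2p h2r h2r i
  have h12 : ∫ x in Ωh, starRingEnd ℂ (Φ₁ x) * opA A 1 Φ₂ x =
      (∫ x in Ωh, starRingEnd ℂ (Φ₁ x) * opA A 0 Φ₂ x) * Complex.I := by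
    refine eq_mul_I_of_rot_eigenvector
      (u := fun j => ∫ x in Ωh, starRingEnd ℂ (Φ₁ x) * opA A j Φ₂ x) fun i => ?_
    simpa only [conj_τ_mul_conj_τ] using
      setIntegral_conj_mul_opA_rot hA hper hrot h1 h2 h1p h2p h1r h2r i
  refine ⟨h12, setIntegral_conj_mul_opA_symm hA hper hherm h1 h2 h1p h2p 0, ?_⟩
  rw [setIntegral_conj_mul_opA_symm hA hper hherm h1 h2 h1p h2p 1, h12, map_mul, Complex.conj_I]
end
end
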